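/- Assume the coercivity condition (C) and the monotonicity assumption (M). Let λ > 0, (z,k) ∈ 𝕋ⁿ×𝕀, and ν = (ν_i)_{i∈𝕀} ∈ P_{B^λ}. Then ν ∈ G'(z,k,λ) if and only if for every ψ = (ψ_i)_{i∈𝕀} ∈ C¹(𝕋ⁿ)ᵐ one has Σ_{i∈𝕀} ⟨ν_i, (B^λψ)_i − g_i·Dψ_i⟩ = ψ_k(z), where (B^λψ)_i − g_i·Dψ_i denotes the continuous function (x,ξ) ↦ λψ_i(x) + Σ_{j∈𝕀} b_{ij}(x)ψ_j(x) − g_i(x,ξ)·Dψ_i(x). -/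

import Mathlib

open MeasureTheory Filter Topology RealInnerProductSpace

noncomputable section

/-- Euclidean space ℝⁿ, the universal cover of the flat torus 𝕋ⁿ = ℝⁿ/ℤⁿ. -/
abbrev Euc (n : ℕ) := EuclideanSpace ℝ (Fin n)

/-- A vector of ℝⁿ with integer coordinates (an element of ℤⁿ). -/
def IsIntVec {n : ℕ} (z : Euc n) : Prop := ∀ i, ∃ k : ℤ, z i = (k : ℝ)

/-- ℤⁿ-periodic functions on ℝⁿ: these represent functions on the torus 𝕋ⁿ. -/
def TorusFun {n : ℕ} {α : Type*} (f : Euc n → α) : Prop :=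
  ∀ (x z : Euc n), IsIntVec z → f (x + z) = f x

/-- Functions on 𝕋ⁿ × Ξ, i.e. ℤⁿ-periodic in the first variable. -/
def TorusFun2 {n : ℕ} {Ξ : Type*} {α : Type*} (f : Euc n × Ξ → α) : Prop :=
  ∀ (x z : Euc n) (ξ : Ξ), IsIntVec z → f (x + z, ξ) = f (x, ξ)

/-- The Hamiltonian H_{φ,i}(x,p) = sup_{ξ∈Ξ} (−g_i(x,ξ)·p − φ_i(x,ξ)). -/
def ham {n m : ℕ} {Ξ : Type*} (g : Fin m → Euc n × Ξ → Euc n)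
    (φ : Fin m → Euc n × Ξ → ℝ) (i : Fin m) (x p : Euc n) : ℝ :=
  ⨆ ξ : Ξ, (-⟪g i (x, ξ), p⟫ - φ i (x, ξ))

/-- The data g = (g_i), L = (L_i) consist of continuous functions on 𝕋ⁿ × Ξ. -/
def GoodData {n m : ℕ} {Ξ : Type*} [TopologicalSpace Ξ]
    (g : Fin m → Euc n × Ξ → Euc n) (L : Fin m → Euc n × Ξ → ℝ) : Prop :=
  (∀ i, Continuous (g i) ∧ TorusFun2 (g i)) ∧ (∀ i, Continuous (L i) ∧ TorusFun2 (L i))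

/-- Coercivity (C): min_{x∈𝕋ⁿ} H_i(x,p) → ∞ as |p| → ∞. -/
def Coercive {n m : ℕ} {Ξ : Type*} (g : Fin m → Euc n × Ξ → Euc n)
    (L : Fin m → Euc n × Ξ → ℝ) : Prop :=
  ∀ (i : Fin m) (M : ℝ), ∃ R : ℝ, ∀ p : Euc n, R ≤ ‖p‖ → ∀ x : Euc n, M ≤ ham g L i x p

/-- A monotone m×m real matrix. -/
def IsMonotoneMat {m : ℕ} (B : Matrix (Fin m) (Fin m) ℝ) : Prop :=
  ∀ (u : Fin m → ℝ) (k : Fin m), (∀ i, u i ≤ u k) → 0 ≤ u k → 0 ≤ ∑ j, B k j * u j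

/-- Assumption (M): B(x) has continuous entries (as functions on 𝕋ⁿ) and is monotone
for every x. -/
def GoodCoupling {n m : ℕ} (B : Euc n → Matrix (Fin m) (Fin m) ℝ) : Prop :=
  (∀ i j, Continuous (fun x => B x i j) ∧ TorusFun (fun x => B x i j)) ∧
    ∀ x, IsMonotoneMat (B x)

/-- Viscosity subsolution of λu + Bu + H_φ[u] = c in 𝕋ⁿ. -/
def IsSubsol {n m : ℕ} {Ξ : Type*} (B : Euc n → Matrix (Fin m) (Fin m) ℝ) (lam : ℝ)
    (g : Fin m → Euc n × Ξ → Euc n) (φ : Fin m → Euc n × Ξ → ℝ)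
    (c : Fin m → ℝ) (u : Fin m → Euc n → ℝ) : Prop :=
  (∀ i, UpperSemicontinuous (u i) ∧ TorusFun (u i)) ∧
    ∀ (i : Fin m) (ψ : Euc n → ℝ), ContDiff ℝ 1 ψ → TorusFun ψ →
      ∀ x : Euc n, IsLocalMax (fun y => u i y - ψ y) x →
        lam * u i x + (∑ j, B x i j * u j x) + ham g φ i x (gradient ψ x) ≤ c i

/-- Viscosity supersolution of λu + Bu + H_φ[u] = c in 𝕋ⁿ. -/
def IsSupersol {n m : ℕ} {Ξ : Type*} (B : Euc n → Matrix (Fin m) (Fin m) ℝ) (lam : ℝ)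
    (g : Fin m → Euc n × Ξ → Euc n) (φ : Fin m → Euc n × Ξ → ℝ)
    (c : Fin m → ℝ) (u : Fin m → Euc n → ℝ) : Prop :=
  (∀ i, LowerSemicontinuous (u i) ∧ TorusFun (u i)) ∧
    ∀ (i : Fin m) (ψ : Euc n → ℝ), ContDiff ℝ 1 ψ → TorusFun ψ →
      ∀ x : Euc n, IsLocalMin (fun y => u i y - ψ y) x →
        c i ≤ lam * u i x + (∑ j, B x i j * u j x) + ham g φ i x (gradient ψ x)

/-- Viscosity solution of λu + Bu + H_φ[u] = c in 𝕋ⁿ. -/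
def IsSol {n m : ℕ} {Ξ : Type*} (B : Euc n → Matrix (Fin m) (Fin m) ℝ) (lam : ℝ)
    (g : Fin m → Euc n × Ξ → Euc n) (φ : Fin m → Euc n × Ξ → ℝ)
    (c : Fin m → ℝ) (u : Fin m → Euc n → ℝ) : Prop :=
  (∀ i, Continuous (u i)) ∧ IsSubsol B lam g φ c u ∧ IsSupersol B lam g φ c u

/-- (φ,u) ∈ F(λ): φ ∈ C(𝕋ⁿ×Ξ)ᵐ, u ∈ C(𝕋ⁿ)ᵐ and u is a viscosity subsolution of
B^λ u + H_φ[u] = 0 in 𝕋ⁿ. -/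
def memF {n m : ℕ} {Ξ : Type*} [TopologicalSpace Ξ]
    (B : Euc n → Matrix (Fin m) (Fin m) ℝ) (lam : ℝ)
    (g : Fin m → Euc n × Ξ → Euc n)
    (φ : Fin m → Euc n × Ξ → ℝ) (u : Fin m → Euc n → ℝ) : Prop :=
  (∀ i, Continuous (φ i) ∧ TorusFun2 (φ i)) ∧ (∀ i, Continuous (u i)) ∧
    IsSubsol B lam g φ (fun _ => 0) u

/-- ρ_i(x) = Σ_j b_{ij}(x). -/
def rhoB {n m : ℕ} (B : Euc n → Matrix (Fin m) (Fin m) ℝ) (i : Fin m) (x : Euc n) : ℝ :=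
  ∑ j, B x i j

/-- ν ∈ P_{B^λ}: a family of finite nonnegative Borel measures with ⟨ν, B^λ1⟩ = 1. -/
def memPB {n m : ℕ} {Ξ : Type*} [MeasurableSpace Ξ]
    (B : Euc n → Matrix (Fin m) (Fin m) ℝ) (lam : ℝ)
    (ν : Fin m → Measure (Euc n × Ξ)) : Prop :=
  (∀ i, IsFiniteMeasure (ν i)) ∧
    (∑ i, ∫ q, (lam + rhoB B i q.1) ∂(ν i)) = 1

/-- ν ∈ G'(z,k,λ): ν ∈ P_{B^λ} and ⟨ν, φ − u_k(z) B^λ1⟩ ≥ 0 for every (φ,u) ∈ F(λ). -/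
def memGP {n m : ℕ} {Ξ : Type*} [TopologicalSpace Ξ] [MeasurableSpace Ξ]
    (B : Euc n → Matrix (Fin m) (Fin m) ℝ) (lam : ℝ)
    (g : Fin m → Euc n × Ξ → Euc n) (z : Euc n) (k : Fin m)
    (ν : Fin m → Measure (Euc n × Ξ)) : Prop :=
  memPB B lam ν ∧
    ∀ φ u, memF B lam g φ u →
      0 ≤ ∑ i, ∫ q, (φ i q - u k z * (lam + rhoB B i q.1)) ∂(ν i)

/-- μ ∈ P: a family of nonnegative Borel measures of total mass 1. -/
def memP {n m : ℕ} {Ξ : Type*} [MeasurableSpace Ξ]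
    (μ : Fin m → Measure (Euc n × Ξ)) : Prop :=
  (∀ i, IsFiniteMeasure (μ i)) ∧ (∑ i, (μ i Set.univ).toReal) = 1

/-- μ ∈ P(z,k,λ): μ ∈ P and Σ_i ⟨μ_i, (λ+ρ_i)⁻¹ φ_i⟩ ≥ u_k(z) for all (φ,u) ∈ F(λ). -/
def memPzk {n m : ℕ} {Ξ : Type*} [TopologicalSpace Ξ] [MeasurableSpace Ξ]
    (B : Euc n → Matrix (Fin m) (Fin m) ℝ) (lam : ℝ)
    (g : Fin m → Euc n × Ξ → Euc n) (z : Euc n) (k : Fin m)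
    (μ : Fin m → Measure (Euc n × Ξ)) : Prop :=
  memP μ ∧
    ∀ φ u, memF B lam g φ u →
      u k z ≤ ∑ i, ∫ q, (lam + rhoB B i q.1)⁻¹ * φ i q ∂(μ i)

/-- μ ∈ P(0): μ ∈ P and ⟨μ,φ⟩ ≥ 0 for all (φ,u) ∈ F(0). -/
def memP0 {n m : ℕ} {Ξ : Type*} [TopologicalSpace Ξ] [MeasurableSpace Ξ]
    (B : Euc n → Matrix (Fin m) (Fin m) ℝ)
    (g : Fin m → Euc n × Ξ → Euc n)
    (μ : Fin m → Measure (Euc n × Ξ)) : Prop :=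
  memP μ ∧ ∀ φ u, memF B 0 g φ u → 0 ≤ ∑ i, ∫ q, φ i q ∂(μ i)

/-- μ ∈ M₊(0): a family of finite nonnegative Borel measures with ⟨μ,φ⟩ ≥ 0 for all
(φ,u) ∈ F(0). -/
def memM0 {n m : ℕ} {Ξ : Type*} [TopologicalSpace Ξ] [MeasurableSpace Ξ]
    (B : Euc n → Matrix (Fin m) (Fin m) ℝ)
    (g : Fin m → Euc n × Ξ → Euc n)
    (μ : Fin m → Measure (Euc n × Ξ)) : Prop :=
  (∀ i, IsFiniteMeasure (μ i)) ∧ ∀ φ u, memF B 0 g φ u → 0 ≤ ∑ i, ∫ q, φ i q ∂(μ i)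

/-- Assumption (E): problem (P₀) has a Lipschitz continuous viscosity solution. -/
def AssumptionE {n m : ℕ} {Ξ : Type*} (B : Euc n → Matrix (Fin m) (Fin m) ℝ)
    (g : Fin m → Euc n × Ξ → Euc n) (L : Fin m → Euc n × Ξ → ℝ) : Prop :=
  ∃ v₀ : Fin m → Euc n → ℝ, (∀ i, ∃ K : NNReal, LipschitzWith K (v₀ i)) ∧
    IsSol B 0 g L (fun _ => 0) v₀

end


theorem exists_intVec_bound (n : ℕ) : ∃ R : ℝ, ∀ x : Euc n, ∃ w : Euc n, IsIntVec w ∧ ‖x + w‖ ≤ R := by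
  have hK : IsCompact ((WithLp.toLp 2 : (Fin n → ℝ) → Euc n) '' (Set.Icc 0 1)) := by
    apply isCompact_Icc.image
    exact PiLp.continuous_toLp 2 _
  obtain ⟨R, hR⟩ := hK.isBounded.exists_norm_le
  refine ⟨R, fun x => ⟨WithLp.toLp 2 (fun i => ((-⌊x i⌋ : ℤ) : ℝ)), fun i => ⟨-⌊x i⌋, rfl⟩, hR _ ?_⟩⟩
  refine ⟨fun i => Int.fract (x i), ⟨fun i => Int.fract_nonneg _, fun i => (Int.fract_lt_one _).le⟩, ?_⟩
  ext i
  simp [Int.fract, sub_eq_add_neg]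

theorem torus2_bdd {n : ℕ} {Ξ E : Type*} [MetricSpace Ξ] [CompactSpace Ξ] [NormedAddCommGroup E]
    (f : Euc n × Ξ → E) (hf : Continuous f) (hp : TorusFun2 f) : ∃ M : ℝ, 0 ≤ M ∧ ∀ q, ‖f q‖ ≤ M := by
  obtain ⟨R, hR⟩ := exists_intVec_bound n
  have hK : IsCompact ((Metric.closedBall (0 : Euc n) R) ×ˢ (Set.univ : Set Ξ)) :=
    (isCompact_closedBall _ _).prod isCompact_univ
  obtain ⟨M, hM⟩ := hK.exists_bound_of_continuousOn hf.continuousOn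
  refine ⟨max M 0, le_max_right _ _, ?_⟩
  rintro ⟨x, ξ⟩
  obtain ⟨w, hw, hx⟩ := hR x
  rw [← hp x w ξ hw]
  exact (hM _ ⟨by simpa using hx, trivial⟩).trans (le_max_left _ _)

theorem torus2_uc {n : ℕ} {Ξ E : Type*} [MetricSpace Ξ] [CompactSpace Ξ] [NormedAddCommGroup E]
    (f : Euc n × Ξ → E) (hf : Continuous f) (hp : TorusFun2 f) (δ : ℝ) (hδ : 0 < δ) :
    ∃ ε > 0, ∀ x t ξ, ‖t‖ < ε → ‖f (x - t, ξ) - f (x, ξ)‖ ≤ δ := by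
  obtain ⟨R, hR⟩ := exists_intVec_bound n
  have hK : IsCompact ((Metric.closedBall (0 : Euc n) (R+1)) ×ˢ (Set.univ : Set Ξ)) :=
    (isCompact_closedBall _ _).prod isCompact_univ
  have := hK.uniformContinuousOn_of_continuous hf.continuousOn
  rw [Metric.uniformContinuousOn_iff] at this
  obtain ⟨ε, hε, h⟩ := this δ hδ
  refine ⟨min ε 1, by positivity, fun x t ξ ht => ?_⟩
  obtain ⟨w, hw, hx⟩ := hR x
  rw [← hp x w ξ hw, ← hp (x - t) w ξ hw, ← dist_eq_norm]
  have h1 : ‖t‖ < ε := ht.trans_le (min_le_left _ _)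
  have h2 : ‖t‖ < 1 := ht.trans_le (min_le_right _ _)
  have e : x - t + w = x + w - t := by abel
  rw [e]
  refine (h _ ⟨?_, trivial⟩ _ ⟨?_, trivial⟩ ?_).le
  · have := norm_sub_le (x + w) t
    simp only [mem_closedBall_zero_iff]; linarith
  · simp only [mem_closedBall_zero_iff]; linarith
  · rw [Prod.dist_eq]
    simp [h1]

/-- periodic test function with gradient `q` at `y`. -/
noncomputable def tst {n : ℕ} (y q : Euc n) (C : ℝ) (w : Euc n) : ℝ :=
  ∑ i, (q i * (Real.sin (2 * Real.pi * (w i - y i)) / (2 * Real.pi)) +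
    C * (1 - Real.cos (2 * Real.pi * (w i - y i))))

theorem tst_contDiff {n : ℕ} (y q : Euc n) (C : ℝ) : ContDiff ℝ 1 (tst y q C) := by
  unfold tst
  fun_prop

theorem tst_torus {n : ℕ} (y q : Euc n) (C : ℝ) : TorusFun (tst y q C) := by
  intro x z hz
  unfold tst
  refine Finset.sum_congr rfl fun i _ => ?_
  obtain ⟨k, hk⟩ := hz i
  have : 2 * Real.pi * ((x + z) i - y i) = 2 * Real.pi * (x i - y i) + k * (2 * Real.pi) := by
    rw [PiLp.add_apply, hk]; ring
  rw [this, Real.sin_add_int_mul_two_pi, Real.cos_add_int_mul_two_pi]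

theorem tst_grad {n : ℕ} (y q : Euc n) (C : ℝ) : gradient (tst y q C) y = q := by
  apply HasGradientAt.gradient
  rw [hasGradientAt_iff_hasFDerivAt]
  have key : ∀ i : Fin n, HasFDerivAt (fun w : Euc n => (q i * (Real.sin (2 * Real.pi * (w i - y i)) / (2 * Real.pi)) +
    C * (1 - Real.cos (2 * Real.pi * (w i - y i))))) (q i • (EuclideanSpace.proj i : Euc n →L[ℝ] ℝ)) y := by
    intro i
    have h1 : HasDerivAt (fun s : ℝ => (q i * (Real.sin (2 * Real.pi * (s - y i)) / (2 * Real.pi)) +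
      C * (1 - Real.cos (2 * Real.pi * (s - y i))))) (q i) (y i) := by
      have h0 : HasDerivAt (fun s : ℝ => 2 * Real.pi * (s - y i)) (2 * Real.pi) (y i) := by
        simpa using ((hasDerivAt_id (y i)).sub_const (y i)).const_mul (2 * Real.pi)
      have := ((h0.sin.div_const (2 * Real.pi)).const_mul (q i)).add ((h0.cos.const_sub 1).const_mul C)
      exact this.congr_deriv (by simp)
    have h2 : HasFDerivAt (fun w : Euc n => w i) (EuclideanSpace.proj i : Euc n →L[ℝ] ℝ) y :=
      (EuclideanSpace.proj i : Euc n →L[ℝ] ℝ).hasFDerivAt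
    exact HasDerivAt.comp_hasFDerivAt y h1 h2
  have := HasFDerivAt.fun_sum (u := Finset.univ) (fun i _ => key i)
  have e : (InnerProductSpace.toDual ℝ (Euc n)) q =
      ∑ i, q i • (EuclideanSpace.proj i : Euc n →L[ℝ] ℝ) := by
    ext w
    simp [PiLp.inner_apply, mul_comm]
  rw [e]
  exact this

theorem trig_lb (a C Q s : ℝ) (ha : |a| ≤ Q) (hC : 0 ≤ C) (hs : |2 * Real.pi * s| ≤ 1) :
    a * s + C * s ^ 2 ≤ a * (Real.sin (2 * Real.pi * s) / (2 * Real.pi)) +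
      (8 * (Q + C)) * (1 - Real.cos (2 * Real.pi * s)) := by
  have hpi := Real.pi_gt_three
  have hpi4 := Real.pi_le_four
  have hQ : 0 ≤ Q := (abs_nonneg a).trans ha
  obtain ⟨S, hS⟩ : ∃ S, S = 2 * Real.pi * s := ⟨_, rfl⟩
  have hs' : s = S / (2 * Real.pi) := by rw [hS]; field_simp
  rw [← hS] at hs ⊢
  have hcos : S ^ 2 / 8 ≤ 1 - Real.cos S := by
    have h := Real.cos_le_one_sub_mul_cos_sq (x := S) (by linarith)
    have h2 : 1 / 8 ≤ 2 / Real.pi ^ 2 := by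
      rw [div_le_div_iff₀ (by norm_num) (by positivity)]; nlinarith
    nlinarith [mul_le_mul_of_nonneg_right h2 (sq_nonneg S)]
  have hsin : |Real.sin S - S| ≤ S ^ 2 := by
    rw [abs_sub_comm]
    refine (Real.abs_sub_sin_le S).trans ?_
    rw [← sq_abs S]
    nlinarith [abs_nonneg S, sq_nonneg |S|, mul_nonneg (sq_nonneg |S|) (sub_nonneg.2 hs)]
  have h1 : a * s - a * (Real.sin S / (2 * Real.pi)) ≤ Q * S ^ 2 := by
    have : a * s - a * (Real.sin S / (2 * Real.pi)) = (-a * (Real.sin S - S)) / (2 * Real.pi) := by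
      rw [hs']; ring
    rw [this, div_le_iff₀ (by positivity)]
    have h2 : -a * (Real.sin S - S) ≤ Q * S ^ 2 := by
      refine (le_abs_self _).trans ?_
      rw [abs_mul, abs_neg]
      exact mul_le_mul ha hsin (abs_nonneg _) hQ
    have : 0 ≤ Q * S ^ 2 := by positivity
    nlinarith
  have h3 : C * s ^ 2 ≤ C * S ^ 2 := by
    apply mul_le_mul_of_nonneg_left _ hC
    rw [hS, mul_pow]
    have : 1 ≤ (2 * Real.pi) ^ 2 := by nlinarith
    nlinarith [sq_nonneg s]
  have h4 : (Q + C) * S ^ 2 ≤ 8 * (Q + C) * (1 - Real.cos S) := by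
    nlinarith
  linarith

theorem lemA {n : ℕ} (u : Euc n → ℝ) (P : Euc n → Euc n → Prop)
    (hV : ∀ ψ : Euc n → ℝ, ContDiff ℝ 1 ψ → TorusFun ψ →
      ∀ x : Euc n, IsLocalMax (fun y => u y - ψ y) x → P x (gradient ψ x))
    (y q : Euc n) (C : ℝ) (hC : 0 ≤ C)
    (h : ∀ᶠ w in 𝓝 y, u w ≤ u y + ⟪q, w - y⟫ + C * ‖w - y‖ ^ 2) : P y q := by
  have := hV (tst y q (8 * (‖q‖ + C))) (tst_contDiff _ _ _) (tst_torus _ _ _) y ?_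
  · rwa [tst_grad] at this
  have hb : ∀ᶠ w in 𝓝 y, ‖w - y‖ < 1 / (2 * Real.pi) := by
    have : ContinuousAt (fun w : Euc n => ‖w - y‖) y := by fun_prop
    apply this.eventually_lt continuousAt_const
    simp [Real.pi_pos]
  filter_upwards [h, hb] with w hw hb
  have h0 : tst y q (8 * (‖q‖ + C)) y = 0 := by simp [tst]
  rw [h0, sub_zero]
  have : ⟪q, w - y⟫ + C * ‖w - y‖ ^ 2 ≤ tst y q (8 * (‖q‖ + C)) w := by
    rw [EuclideanSpace.real_norm_sq_eq, PiLp.inner_apply, Finset.mul_sum, ← Finset.sum_add_distrib]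
    unfold tst
    refine Finset.sum_le_sum fun i _ => ?_
    have hi := PiLp.norm_apply_le (w - y) i
    have hs := trig_lb (q i) C ‖q‖ (w i - y i) (PiLp.norm_apply_le q i) hC (by
      rw [abs_mul, abs_of_pos (by positivity : 0 < 2 * Real.pi)]
      have : |w i - y i| ≤ 1 / (2 * Real.pi) := (show |w i - y i| ≤ ‖w - y‖ from hi).trans hb.le
      calc _ ≤ 2 * Real.pi * (1 / (2 * Real.pi)) := by gcongr
        _ = 1 := by field_simp)
    refine le_trans (le_of_eq ?_) hs
    simp [mul_comm]
  linarith

theorem lemB {n : ℕ} (u : Euc n → ℝ) (hu : Continuous u) (M R : ℝ) (hM : ∀ x, |u x| ≤ M) (hR : 0 < R)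
    (hP : ∀ (y q : Euc n) (C : ℝ), 0 ≤ C →
      (∀ᶠ w in 𝓝 y, u w ≤ u y + ⟪q, w - y⟫ + C * ‖w - y‖ ^ 2) → ‖q‖ < R) (x y : Euc n) :
    u y - u x ≤ R * ‖y - x‖ := by
  have hM0 : 0 ≤ M := (abs_nonneg _).trans (hM 0)
  have hr : 0 ≤ (2 * M + 1) / R := by positivity
  obtain ⟨y0, hy0, hmax⟩ := (isCompact_closedBall x ((2 * M + 1) / R)).exists_isMaxOn
    ⟨x, Metric.mem_closedBall_self hr⟩
    (f := fun y => u y - R * ‖y - x‖) (by fun_prop)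
  have hx := hmax (Metric.mem_closedBall_self hr)
  have hall : ∀ w, u w - R * ‖w - x‖ ≤ u y0 - R * ‖y0 - x‖ := by
    intro w
    by_cases hw : w ∈ Metric.closedBall x ((2 * M + 1) / R)
    · exact hmax hw
    · simp only [Metric.mem_closedBall, dist_eq_norm, not_le] at hw
      rw [div_lt_iff₀ hR] at hw
      simp at hx
      have := abs_le.1 (hM w)
      have := abs_le.1 (hM x)
      linarith
  by_cases e : y0 = x
  · have := hall y
    rw [e] at this
    simp at this
    linarith
  exfalso
  have hpos : 0 < ‖y0 - x‖ := norm_pos_iff.2 (sub_ne_zero.2 e)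
  have := hP y0 ((R / ‖y0 - x‖) • (y0 - x)) (R / (2 * ‖y0 - x‖)) (by positivity) (Eventually.of_forall fun w => ?_)
  · rw [norm_smul, Real.norm_of_nonneg (by positivity), div_mul_cancel₀ _ hpos.ne'] at this
    exact lt_irrefl _ this
  · have h1 := hall w
    have h2 : ‖w - x‖ ^ 2 = ‖y0 - x‖ ^ 2 + 2 * ⟪y0 - x, w - y0⟫ + ‖w - y0‖ ^ 2 := by
      rw [← norm_add_sq_real]; congr 2; abel
    rw [real_inner_smul_left]
    have h3 : ‖w - x‖ - ‖y0 - x‖ ≤ 1 / ‖y0 - x‖ * ⟪y0 - x, w - y0⟫ + 1 / (2 * ‖y0 - x‖) * ‖w - y0‖ ^ 2 := by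
      have : 1 / ‖y0 - x‖ * ⟪y0 - x, w - y0⟫ + 1 / (2 * ‖y0 - x‖) * ‖w - y0‖ ^ 2
        = (‖w - x‖ ^ 2 - ‖y0 - x‖ ^ 2) / (2 * ‖y0 - x‖) := by
        rw [h2]; field_simp; ring
      rw [this, le_div_iff₀ (by positivity)]
      nlinarith [sq_nonneg (‖w - x‖ - ‖y0 - x‖)]
    have h4 := mul_le_mul_of_nonneg_left h3 hR.le
    have h5 : R * (1 / ‖y0 - x‖ * ⟪y0 - x, w - y0⟫ + 1 / (2 * ‖y0 - x‖) * ‖w - y0‖ ^ 2) =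
      R / ‖y0 - x‖ * ⟪y0 - x, w - y0⟫ + R / (2 * ‖y0 - x‖) * ‖w - y0‖ ^ 2 := by ring
    linarith

theorem lemC {n : ℕ} (u : Euc n → ℝ) (hu : Continuous u) (P : Euc n → Euc n → Prop)
    (hcl : IsClosed {a : Euc n × Euc n | P a.1 a.2})
    (hP : ∀ (y q : Euc n) (C : ℝ), 0 ≤ C →
      (∀ᶠ w in 𝓝 y, u w ≤ u y + ⟪q, w - y⟫ + C * ‖w - y‖ ^ 2) → P y q) (x : Euc n)
    (hd : DifferentiableAt ℝ u x) : P x (gradient u x) := by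
  set p := gradient u x with hp
  have hg : HasGradientAt u p x := hd.hasGradientAt
  have : (x, p) ∈ {a : Euc n × Euc n | P a.1 a.2} := by
    rw [← hcl.closure_eq, Metric.mem_closure_iff]
    intro ε' hε'
    obtain ⟨ε, hε, hεε⟩ : ∃ ε, 0 < ε ∧ 2 * ε < ε' := ⟨ε' / 4, by linarith, by linarith⟩
    have ho := (hasGradientAt_iff_isLittleO.1 hg).bound (c := ε / 2) (by linarith)
    obtain ⟨r0, hr0, hball⟩ := Metric.eventually_nhds_iff_ball.1 ho
    obtain ⟨r, hr, hrr0, hrε⟩ : ∃ r, 0 < r ∧ r < r0 ∧ r < ε :=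
      ⟨min r0 ε / 2, by positivity, by linarith [min_le_left r0 ε, lt_min hr0 hε],
        by linarith [min_le_right r0 ε, lt_min hr0 hε]⟩
    obtain ⟨y0, hy0, hmax⟩ := (isCompact_closedBall x r).exists_isMaxOn
      ⟨x, Metric.mem_closedBall_self hr.le⟩
      (f := fun y => u y - ⟪p, y - x⟫ - ε / r * ‖y - x‖ ^ 2) (by fun_prop)
    have hx := hmax (Metric.mem_closedBall_self hr.le)
    simp at hx
    have hy0' : ‖y0 - x‖ < r := by
      have h1 : ‖y0 - x‖ ≤ r := by simpa [dist_eq_norm] using hy0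
      refine lt_of_le_of_ne h1 fun e => ?_
      have h2 := hball y0 (by simp [dist_eq_norm]; linarith)
      rw [e] at h2 hx
      have h3 := (abs_le.1 h2).2
      have : ε / r * r ^ 2 = ε * r := by field_simp
      nlinarith [mul_pos hε hr]
    refine ⟨(y0, p + (2 * (ε / r)) • (y0 - x)), ?_, ?_⟩
    · refine hP _ _ (ε / r) (by positivity) ?_
      have : Metric.ball x r ∈ 𝓝 y0 := Metric.isOpen_ball.mem_nhds (by simpa [dist_eq_norm] using hy0')
      filter_upwards [this] with w hw
      have h1 := hmax (Metric.ball_subset_closedBall hw)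
      simp only [Set.mem_ofPred_eq] at h1
      have h2 : ‖w - x‖ ^ 2 = ‖y0 - x‖ ^ 2 + 2 * ⟪y0 - x, w - y0⟫ + ‖w - y0‖ ^ 2 := by
        rw [← norm_add_sq_real]; congr 2; abel
      have h3 : ⟪p, w - x⟫ = ⟪p, w - y0⟫ + ⟪p, y0 - x⟫ := by
        rw [← inner_add_right]; congr 1; abel
      rw [h2, h3] at h1
      rw [inner_add_left, real_inner_smul_left]
      linarith
    · rw [Prod.dist_eq, max_lt_iff]
      constructor
      · simp only [dist_comm x y0, dist_eq_norm]; linarith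
      · simp only [dist_eq_norm, sub_add_cancel_left, norm_neg, norm_smul]
        rw [Real.norm_of_nonneg (by positivity)]
        have : 2 * (ε / r) * ‖y0 - x‖ ≤ 2 * (ε / r) * r := by gcongr
        have h2 : 2 * (ε / r) * r = 2 * ε := by field_simp
        linarith
  exact this

theorem inner_grad {n : ℕ} (f : Euc n → ℝ) (a x : Euc n) : ⟪a, gradient f x⟫ = fderiv ℝ f x a := by
  rw [real_inner_comm, gradient, InnerProductSpace.toDual_symm_apply]

/-- mollification -/
noncomputable def mol {n : ℕ} (ρ : ContDiffBump (0 : Euc n)) (v : Euc n → ℝ) (x : Euc n) : ℝ :=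
  ∫ t, ρ.normed volume t * v (x - t)

theorem mol_torus {n : ℕ} (ρ : ContDiffBump (0 : Euc n)) (v : Euc n → ℝ) (hv : TorusFun v) :
    TorusFun (mol ρ v) := by
  intro x z hz
  unfold mol
  congr 1
  ext t
  rw [← hv (x - t) z hz]
  congr 2
  abel

theorem mol_contDiff {n : ℕ} (ρ : ContDiffBump (0 : Euc n)) (v : Euc n → ℝ) (hv : Continuous v) :
    ContDiff ℝ 1 (mol ρ v) := by
  have := HasCompactSupport.contDiff_convolution_left (μ := (volume : Measure (Euc n))) (n := 1)
    (ContinuousLinearMap.lsmul ℝ ℝ)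
    (ρ.hasCompactSupport_normed (μ := volume)) ρ.contDiff_normed hv.locallyIntegrable
  exact this

theorem mol_int {n : ℕ} (ρ : ContDiffBump (0 : Euc n)) (v : Euc n → ℝ) (hv : Continuous v) (x : Euc n) :
    Integrable (fun t => ρ.normed volume t * v (x - t)) := by
  apply Continuous.integrable_of_hasCompactSupport
  · have := ρ.continuous_normed (μ := volume); fun_prop
  · exact (ρ.hasCompactSupport_normed (μ := volume)).mul_right

theorem mol_grad {n : ℕ} (ρ : ContDiffBump (0 : Euc n)) (v : Euc n → ℝ) (K : NNReal)
    (hv : LipschitzWith K v) (x a : Euc n) :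
    Integrable (fun t => ρ.normed volume t * ⟪a, gradient v (x - t)⟫) ∧
    ⟪a, gradient (mol ρ v) x⟫ = ∫ t, ρ.normed volume t * ⟪a, gradient v (x - t)⟫ := by
  have hae : ∀ᵐ t : Euc n, DifferentiableAt ℝ v (x - t) :=
    (Measure.measurePreserving_sub_left volume x).quasiMeasurePreserving.ae hv.ae_differentiableAt
  have key := hasFDerivAt_integral_of_dominated_loc_of_lip (𝕜 := ℝ) (μ := (volume : Measure (Euc n)))
    (F := fun y t => ρ.normed volume t * v (y - t))
    (F' := fun t => ρ.normed volume t • fderiv ℝ v (x - t)) (x₀ := x) (s := Set.univ)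
    (bound := fun t => ρ.normed volume t * K) univ_mem
    (Eventually.of_forall fun y => (mol_int ρ v hv.continuous y).aestronglyMeasurable)
    (mol_int ρ v hv.continuous x) ?_ ?_ ?_ ?_
  · obtain ⟨hi, hd⟩ := key
    have hi' := hi.apply_continuousLinearMap a
    simp only [inner_grad]
    refine ⟨hi', ?_⟩
    have : fderiv ℝ (mol ρ v) x = ∫ t, ρ.normed volume t • fderiv ℝ v (x - t) := hd.fderiv
    rw [this, ContinuousLinearMap.integral_apply hi]
    rfl
  · apply AEStronglyMeasurable.fun_smul
    · exact ρ.continuous_normed.aestronglyMeasurable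
    · exact ((measurable_fderiv ℝ v).comp (measurable_const.sub measurable_id)).aestronglyMeasurable
  · refine Eventually.of_forall fun t => ?_
    refine LipschitzOnWith.of_dist_le_mul fun y _ w _ => ?_
    have h0 := ρ.nonneg_normed (μ := volume) t
    have h1 := hv.dist_le_mul (y - t) (w - t)
    rw [dist_sub_right] at h1
    rw [Real.dist_eq] at *
    rw [← mul_sub, abs_mul, abs_of_nonneg h0, Real.coe_nnabs,
      abs_of_nonneg (mul_nonneg h0 K.coe_nonneg), mul_assoc]
    exact mul_le_mul_of_nonneg_left h1 h0
  · exact ρ.integrable_normed.mul_const _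
  · filter_upwards [hae] with t ht
    have h1 : HasFDerivAt (fun y => v (y - t)) (fderiv ℝ v (x - t)) x := by
      have h2 := ht.hasFDerivAt.comp x ((hasFDerivAt_id x).sub_const t)
      rw [ContinuousLinearMap.comp_id] at h2
      exact h2
    exact h1.const_mul _

theorem mol_le {n : ℕ} (ρ : ContDiffBump (0 : Euc n)) (f : Euc n → ℝ) (A : ℝ)
    (hf : Integrable (fun t => ρ.normed volume t * f t))
    (h : ∀ᵐ t : Euc n, ‖t‖ < ρ.rOut → f t ≤ A) :
    ∫ t, ρ.normed volume t * f t ≤ A := by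
  have : ∫ t, ρ.normed volume t * f t ≤ ∫ t, ρ.normed volume t * A := by
    apply integral_mono_ae hf (ρ.integrable_normed.mul_const _)
    filter_upwards [h] with t ht
    by_cases h2 : ‖t‖ < ρ.rOut
    · exact mul_le_mul_of_nonneg_left (ht h2) (ρ.nonneg_normed t)
    · have : ρ.normed volume t = 0 := by
        rw [← Function.notMem_support, ρ.support_normed_eq]
        simpa using h2
      simp [this]
  rwa [integral_mul_const, ρ.integral_normed, one_mul] at this

theorem torus2_int {n : ℕ} {Ξ : Type*} [MetricSpace Ξ] [CompactSpace Ξ]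
    [MeasurableSpace Ξ] [BorelSpace Ξ]
    (f : Euc n × Ξ → ℝ) (hf : Continuous f) (hp : TorusFun2 f) (μ : Measure (Euc n × Ξ))
    [IsFiniteMeasure μ] : Integrable f μ := by
  obtain ⟨M, _, hM⟩ := torus2_bdd f hf hp
  exact Integrable.of_bound hf.aestronglyMeasurable M (Eventually.of_forall hM)

theorem torus2_uc' {n : ℕ} {Ξ E : Type*} [MetricSpace Ξ] [CompactSpace Ξ] [NormedAddCommGroup E]
    (f : Euc n × Ξ → E) (hf : Continuous f) (hp : TorusFun2 f) (δ : ℝ) (hδ : 0 < δ) :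
    ∀ᶠ ε in 𝓝[>] (0 : ℝ), ∀ x t ξ, ‖t‖ < ε → ‖f (x - t, ξ) - f (x, ξ)‖ ≤ δ := by
  obtain ⟨ε, hε, h⟩ := torus2_uc f hf hp δ hδ
  filter_upwards [Ioo_mem_nhdsGT hε] with e he x t ξ ht
  exact h x t ξ (ht.trans he.2)

theorem grad_cont {n : ℕ} (f : Euc n → ℝ) (hf : ContDiff ℝ 1 f) : Continuous (gradient f) := by
  have := hf.continuous_fderiv one_ne_zero
  exact (InnerProductSpace.toDual ℝ (Euc n)).symm.continuous.comp this

theorem grad_torus {n : ℕ} (f : Euc n → ℝ) (hf : TorusFun f) : TorusFun (gradient f) := by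
  intro x z hz
  unfold gradient
  congr 1
  have h : (fun y => f (y + z)) = f := funext fun y => hf y z hz
  rw [← fderiv_comp_add_right, h]

section main
variable {n m : ℕ} {Ξ : Type*} [MetricSpace Ξ] [CompactSpace Ξ]

/-- The linear operator. -/
noncomputable def linop (g : Fin m → Euc n × Ξ → Euc n) (B : Euc n → Matrix (Fin m) (Fin m) ℝ) (lam : ℝ)
    (ψ : Fin m → Euc n → ℝ) (i : Fin m) (q : Euc n × Ξ) : ℝ :=
  lam * ψ i q.1 + (∑ j, B q.1 i j * ψ j q.1) - ⟪g i q, gradient (ψ i) q.1⟫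

theorem linop_good (g : Fin m → Euc n × Ξ → Euc n) (L : Fin m → Euc n × Ξ → ℝ)
    (hgL : GoodData g L) (B : Euc n → Matrix (Fin m) (Fin m) ℝ) (hB : GoodCoupling B)
    (lam : ℝ) (ψ : Fin m → Euc n → ℝ) (hψ : ∀ i, ContDiff ℝ 1 (ψ i) ∧ TorusFun (ψ i)) (i : Fin m) :
    Continuous (linop g B lam ψ i) ∧ TorusFun2 (linop g B lam ψ i) := by
  constructor
  · unfold linop
    have h1 := fun j => (hψ j).1.continuous
    have h2 := grad_cont _ (hψ i).1
    have h3 := fun j => (hB.1 i j).1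
    have h4 := (hgL.1 i).1
    fun_prop
  · intro x z ξ hz
    unfold linop
    have h1 := fun j => (hψ j).2 x z hz
    have h2 := grad_torus _ (hψ i).2 x z hz
    have h3 := fun j => (hB.1 i j).2 x z hz
    have h4 := (hgL.1 i).2 x z ξ hz
    simp only [h1, h2, h3, h4]

theorem ham_bdd (g : Fin m → Euc n × Ξ → Euc n) (φ : Fin m → Euc n × Ξ → ℝ) (i : Fin m)
    (hg : Continuous (g i)) (hφ : Continuous (φ i)) (x p : Euc n) (ξ : Ξ) :
    -⟪g i (x, ξ), p⟫ - φ i (x, ξ) ≤ ham g φ i x p := by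
  apply le_ciSup (f := fun ξ => -⟪g i (x, ξ), p⟫ - φ i (x, ξ))
  have : Continuous (fun ξ => -⟪g i (x, ξ), p⟫ - φ i (x, ξ)) := by fun_prop
  exact (isCompact_range this).bddAbove

theorem sub_smooth [Nonempty Ξ] (g : Fin m → Euc n × Ξ → Euc n) (L : Fin m → Euc n × Ξ → ℝ)
    (hgL : GoodData g L) (B : Euc n → Matrix (Fin m) (Fin m) ℝ) (hB : GoodCoupling B)
    (lam : ℝ) (ψ : Fin m → Euc n → ℝ) (hψ : ∀ i, ContDiff ℝ 1 (ψ i) ∧ TorusFun (ψ i)) :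
    memF B lam g (linop g B lam ψ) ψ := by
  refine ⟨linop_good g L hgL B hB lam ψ hψ, fun i => (hψ i).1.continuous,
    fun i => ⟨(hψ i).1.continuous.upperSemicontinuous, (hψ i).2⟩, ?_⟩
  intro i χ hχ _ x hx
  have h1 : DifferentiableAt ℝ (ψ i) x := (hψ i).1.differentiable one_ne_zero x
  have h2 : DifferentiableAt ℝ χ x := hχ.differentiable one_ne_zero x
  have h3 := hx.fderiv_eq_zero
  rw [fderiv_fun_sub h1 h2, sub_eq_zero] at h3
  have h4 : gradient χ x = gradient (ψ i) x := by unfold gradient; rw [h3]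
  have : ham g (linop g B lam ψ) i x (gradient χ x) ≤ -(lam * ψ i x + (∑ j, B x i j * ψ j x)) := by
    apply ciSup_le
    intro ξ
    simp only [linop, h4]
    linarith
  linarith

theorem sub_mol [Nonempty Ξ] (g : Fin m → Euc n × Ξ → Euc n) (L : Fin m → Euc n × Ξ → ℝ)
    (hgL : GoodData g L) (hcoer : Coercive g L)
    (B : Euc n → Matrix (Fin m) (Fin m) ℝ) (hB : GoodCoupling B)
    (lam : ℝ) (φ : Fin m → Euc n × Ξ → ℝ) (u : Fin m → Euc n → ℝ) (hF : memF B lam g φ u)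
    (z : Euc n) (k : Fin m) (δ : ℝ) (hδ : 0 < δ) :
    ∃ ψ : Fin m → Euc n → ℝ, (∀ i, ContDiff ℝ 1 (ψ i) ∧ TorusFun (ψ i)) ∧
      u k z ≤ ψ k z + δ ∧ ∀ i q, linop g B lam ψ i q ≤ φ i q + δ := by
  obtain ⟨hφ, huc, hus, hsub⟩ := hF
  have hut := fun i => (hus i).2
  obtain ⟨ξ₀⟩ := ‹Nonempty Ξ›
  haveI : Nonempty Ξ := ⟨ξ₀⟩
  -- the zeroth order part
  let c : Fin m → Euc n → ℝ := fun i x => lam * u i x + ∑ j, B x i j * u j x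
  have hBc := fun i j => (hB.1 i j).1
  have hcc : ∀ i, Continuous (c i) := by
    intro i
    have := hBc i
    fun_prop
  have hct : ∀ i, TorusFun (c i) := by
    intro i x w hw
    have h1 := fun j => hut j x w hw
    have h3 := fun j => (hB.1 i j).2 x w hw
    simp only [c, h1, h3]
  let P : Fin m → Euc n → Euc n → Prop := fun i y q => ∀ ξ, c i y - ⟪g i (y, ξ), q⟫ - φ i (y, ξ) ≤ 0
  have hPv : ∀ i (ψ : Euc n → ℝ), ContDiff ℝ 1 ψ → TorusFun ψ →
      ∀ x : Euc n, IsLocalMax (fun y => u i y - ψ y) x → P i x (gradient ψ x) := by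
    intro i ψ h1 h2 x h3 ξ
    have h4 := hsub i ψ h1 h2 x h3
    have h5 := ham_bdd g φ i (hgL.1 i).1 (hφ i).1 x (gradient ψ x) ξ
    simp only [c]
    linarith
  have hPq := fun i => lemA (u i) (P i) (hPv i)
  have hPcl : ∀ i, IsClosed {a : Euc n × Euc n | P i a.1 a.2} := by
    intro i
    have hg := (hgL.1 i).1
    have hf := (hφ i).1
    have hc := hcc i
    simp only [P, Set.ofPred_forall]
    refine isClosed_iInter fun ξ => isClosed_le ?_ continuous_const
    fun_prop
  -- bounds
  have hub : ∃ M : ℝ, 0 ≤ M ∧ ∀ i x, |u i x| ≤ M := by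
    have := fun i => torus2_bdd (fun q : Euc n × Ξ => u i q.1) ((huc i).comp continuous_fst)
      (fun x w ξ hw => hut i x w hw)
    choose M hM0 hM using this
    refine ⟨∑ i, M i, Finset.sum_nonneg fun i _ => hM0 i, fun i x => (hM i (x, ξ₀)).trans ?_⟩
    exact Finset.single_le_sum (fun i _ => hM0 i) (Finset.mem_univ i)
  obtain ⟨M, hM0, hM⟩ := hub
  have hPb : ∀ i, ∃ R : ℝ, ∀ y q, P i y q → ‖q‖ < R := by
    intro i
    obtain ⟨A, hA0, hA⟩ := torus2_bdd (fun q : Euc n × Ξ => c i q.1) ((hcc i).comp continuous_fst)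
      (fun x w ξ hw => hct i x w hw)
    obtain ⟨D, hD0, hD⟩ := torus2_bdd (fun q : Euc n × Ξ => φ i q - L i q)
      ((hφ i).1.sub (hgL.2 i).1)
      (fun x w ξ hw => by simp only [(hφ i).2 x w ξ hw, (hgL.2 i).2 x w ξ hw])
    obtain ⟨R, hR⟩ := hcoer i (A + D + 1)
    refine ⟨R, fun y q hq => ?_⟩
    by_contra hlt
    have h1 := hR q (not_lt.1 hlt) y
    have h2 : ham g L i y q ≤ A + D := by
      apply ciSup_le
      intro ξ
      have h3 := hq ξ
      have h4 := abs_le.1 (hA (y, ξ))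
      have h5 := abs_le.1 (hD (y, ξ))
      simp only at h4 h5
      linarith
    linarith
  have hKex : ∃ K : NNReal, ∀ i y q, P i y q → ‖q‖ < K := by
    choose R hR using hPb
    refine ⟨∑ i, (R i).toNNReal, fun i y q h => (hR i y q h).trans_le ?_⟩
    refine (Real.le_coe_toNNReal _).trans ?_
    exact_mod_cast Finset.single_le_sum (f := fun i => (R i).toNNReal) (fun i _ => zero_le) (Finset.mem_univ i)
  obtain ⟨K, hK⟩ := hKex
  obtain ⟨K', hK'⟩ : ∃ K' : NNReal, K' = K + 1 := ⟨_, rfl⟩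
  have hlip : ∀ i, LipschitzWith K' (u i) := by
    intro i
    have hR : (0:ℝ) < K' := by rw [hK']; positivity
    have := lemB (u i) (huc i) M K' (hM i) hR
      (fun y q C hC h => (hK i y q (hPq i y q C hC h)).trans_le (by rw [hK']; push_cast; linarith))
    refine LipschitzWith.of_dist_le_mul fun x y => ?_
    rw [Real.dist_eq, dist_eq_norm, abs_le]
    have h1 := this x y
    have h2 := this y x
    rw [norm_sub_rev] at h1
    constructor <;> linarith
  have hPd := fun i => lemC (u i) (huc i) (P i) (hPcl i) (hPq i)
  -- choice of ε
  obtain ⟨η, hη, hηδ⟩ : ∃ η : ℝ, 0 < η ∧ η * (1 + m * M + K) ≤ δ :=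
    ⟨δ / (1 + m * M + K), by positivity, by rw [div_mul_cancel₀]; positivity⟩
  have e1 : ∀ᶠ ε in 𝓝[>] (0 : ℝ), ∀ i, ∀ x t ξ, ‖t‖ < ε → ‖φ i (x - t, ξ) - φ i (x, ξ)‖ ≤ η :=
    eventually_all.2 fun i => torus2_uc' _ (hφ i).1 (hφ i).2 η hη
  have e2 : ∀ᶠ ε in 𝓝[>] (0 : ℝ), ∀ i, ∀ x t ξ, ‖t‖ < ε → ‖g i (x - t, ξ) - g i (x, ξ)‖ ≤ η :=
    eventually_all.2 fun i => torus2_uc' _ (hgL.1 i).1 (hgL.1 i).2 η hη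
  have e3 : ∀ᶠ ε in 𝓝[>] (0 : ℝ), ∀ i j, ∀ x t (ξ : Ξ), ‖t‖ < ε → ‖B (x - t) i j - B x i j‖ ≤ η :=
    eventually_all.2 fun i => eventually_all.2 fun j =>
      torus2_uc' (fun q : Euc n × Ξ => B q.1 i j) ((hBc i j).comp continuous_fst)
        (fun x w ξ hw => (hB.1 i j).2 x w hw) η hη
  have e4 : ∀ᶠ ε in 𝓝[>] (0 : ℝ), ε * K' ≤ δ := by
    have : Tendsto (fun ε : ℝ => ε * K') (𝓝[>] 0) (𝓝 (0 * K')) :=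
      ((continuous_id.mul continuous_const).tendsto 0).mono_left nhdsWithin_le_nhds
    rw [zero_mul] at this
    exact this.eventually_le_const hδ
  obtain ⟨ε, ⟨⟨⟨⟨h1, h2⟩, h3⟩, h4⟩, h5⟩⟩ :=
    ((((e1.and e2).and e3).and e4).and (self_mem_nhdsWithin (s := Set.Ioi (0:ℝ)))).exists
  have hε : 0 < ε := h5
  let ρ : ContDiffBump (0 : Euc n) := ⟨ε / 2, ε, by positivity, by linarith⟩
  have hρ : ρ.rOut = ε := rfl
  refine ⟨fun i => mol ρ (u i), fun i => ⟨mol_contDiff ρ _ (huc i), mol_torus ρ _ (hut i)⟩, ?_, ?_⟩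
  · have := mol_le ρ (fun t => u k z - u k (z - t)) δ (by
      simp only [mul_sub]
      exact (ρ.integrable_normed.mul_const _).sub (mol_int ρ _ (huc k) z))
      (Eventually.of_forall fun t ht => by
        have := (hlip k).dist_le_mul z (z - t)
        rw [Real.dist_eq, dist_eq_norm, sub_sub_cancel] at this
        have h6 : K' * ‖t‖ ≤ K' * ε := by gcongr
        linarith [le_abs_self (u k z - u k (z - t))])
    simp only [mul_sub] at this
    rw [integral_sub (ρ.integrable_normed.mul_const _) (mol_int ρ _ (huc k) z), integral_mul_const,
      ρ.integral_normed, one_mul] at this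
    simp only [mol]
    linarith
  · rintro i ⟨x, ξ⟩
    obtain ⟨hgi, hge⟩ := mol_grad ρ (u i) K' (hlip i) x (g i (x, ξ))
    have hi1 := (mol_int ρ _ (huc i) x).const_mul lam
    have hi2' := fun j => (mol_int ρ _ (huc j) x).const_mul (B x i j)
    have hi2 := integrable_finsetSum (Finset.univ : Finset (Fin m)) (fun j _ => hi2' j)
    have hi12 : Integrable (fun t => lam * (ρ.normed volume t * u i (x - t)) +
        ∑ j, B x i j * (ρ.normed volume t * u j (x - t))) := hi1.add hi2
    have heq : linop g B lam (fun i => mol ρ (u i)) i (x, ξ) = ∫ t, ρ.normed volume t *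
        (lam * u i (x - t) + ∑ j, B x i j * u j (x - t) - ⟪g i (x, ξ), gradient (u i) (x - t)⟫) := by
      have : ∀ t, ρ.normed volume t *
        (lam * u i (x - t) + ∑ j, B x i j * u j (x - t) - ⟪g i (x, ξ), gradient (u i) (x - t)⟫)
        = lam * (ρ.normed volume t * u i (x - t)) + ∑ j, B x i j * (ρ.normed volume t * u j (x - t))
          - ρ.normed volume t * ⟪g i (x, ξ), gradient (u i) (x - t)⟫ := by
        intro t
        rw [mul_sub, mul_add, Finset.mul_sum]
        simp only [mul_left_comm]
      simp only [this]
      rw [integral_sub hi12 hgi, integral_add hi1 hi2, ← hge,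
        integral_finsetSum _ (fun j _ => hi2' j)]
      simp only [integral_const_mul, linop, mol]
    rw [heq]
    apply mol_le
    · have := (hi1.add hi2).sub hgi
      refine this.congr (Eventually.of_forall fun t => ?_)
      simp only [Pi.add_apply, Pi.sub_apply]
      rw [mul_sub, mul_add, Finset.mul_sum]
      simp only [mul_left_comm]
    · have hae : ∀ᵐ t : Euc n, DifferentiableAt ℝ (u i) (x - t) :=
        (Measure.measurePreserving_sub_left volume x).quasiMeasurePreserving.ae
          (hlip i).ae_differentiableAt
      filter_upwards [hae] with t ht hte
      have hp := hPd i (x - t) ht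
      have hpK := (hK i _ _ hp).le
      have hp' := hp ξ
      simp only [c] at hp'
      have b1 := (abs_le.1 (h1 i x t ξ hte)).2
      have b2 : ⟪g i (x - t, ξ), gradient (u i) (x - t)⟫ - ⟪g i (x, ξ), gradient (u i) (x - t)⟫ ≤ η * K := by
        rw [← inner_sub_left]
        refine (real_inner_le_norm _ _).trans ?_
        exact mul_le_mul (h2 i x t ξ hte) hpK (norm_nonneg _) hη.le
      have b3 : ∑ j, B x i j * u j (x - t) - ∑ j, B (x - t) i j * u j (x - t) ≤ m * (η * M) := by
        rw [← Finset.sum_sub_distrib]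
        refine (Finset.sum_le_card_nsmul _ _ (η * M) fun j _ => ?_).trans (by simp)
        rw [← sub_mul]
        refine (le_abs_self _).trans ?_
        rw [abs_mul, abs_sub_comm]
        exact mul_le_mul (h3 i j x t ξ hte) (hM j _) (abs_nonneg _) hη.le
      linarith

end main

theorem stmt8 {n m : ℕ} (hn : 0 < n) (hm : 0 < m)
    {Ξ : Type*} [MetricSpace Ξ] [CompactSpace Ξ] [Nonempty Ξ]
    [MeasurableSpace Ξ] [BorelSpace Ξ]
    (g : Fin m → Euc n × Ξ → Euc n) (L : Fin m → Euc n × Ξ → ℝ)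
    (hgL : GoodData g L) (hcoer : Coercive g L)
    (B : Euc n → Matrix (Fin m) (Fin m) ℝ) (hB : GoodCoupling B)
    (lam : ℝ) (hlam : 0 < lam) (z : Euc n) (k : Fin m)
    (ν : Fin m → Measure (Euc n × Ξ)) (hν : memPB B lam ν) :
    memGP B lam g z k ν ↔
      ∀ ψ : Fin m → Euc n → ℝ, (∀ i, ContDiff ℝ 1 (ψ i) ∧ TorusFun (ψ i)) →
        (∑ i, ∫ q, (lam * ψ i q.1 + (∑ j, B q.1 i j * ψ j q.1)
            - ⟪g i q, gradient (ψ i) q.1⟫) ∂(ν i)) = ψ k z := by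
  obtain ⟨hfin, hone⟩ := hν
  have hrho : ∀ i, Continuous (fun q : Euc n × Ξ => lam + rhoB B i q.1) ∧
      TorusFun2 (fun q : Euc n × Ξ => lam + rhoB B i q.1) := by
    intro i
    constructor
    · have := fun j => (hB.1 i j).1
      unfold rhoB
      fun_prop
    · intro x w ξ hw
      have h3 := fun j => (hB.1 i j).2 x w hw
      simp only [rhoB, h3]
  have hsplit : ∀ (φ : Fin m → Euc n × Ξ → ℝ) (a : ℝ),
      (∀ i, Continuous (φ i) ∧ TorusFun2 (φ i)) →
      ∑ i, ∫ q, (φ i q - a * (lam + rhoB B i q.1)) ∂(ν i) = (∑ i, ∫ q, φ i q ∂(ν i)) - a := by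
    intro φ a hφ
    have : ∀ i, ∫ q, (φ i q - a * (lam + rhoB B i q.1)) ∂(ν i) =
        (∫ q, φ i q ∂(ν i)) - a * ∫ q, (lam + rhoB B i q.1) ∂(ν i) := by
      intro i
      haveI := hfin i
      rw [integral_sub (torus2_int _ (hφ i).1 (hφ i).2 _)
        ((torus2_int _ (hrho i).1 (hrho i).2 _).const_mul a), integral_const_mul]
    simp only [this]
    rw [Finset.sum_sub_distrib, ← Finset.mul_sum, hone, mul_one]
  constructor
  · rintro ⟨-, hG⟩ ψ hψ
    have key : ∀ ψ : Fin m → Euc n → ℝ, (∀ i, ContDiff ℝ 1 (ψ i) ∧ TorusFun (ψ i)) →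
        ψ k z ≤ ∑ i, ∫ q, linop g B lam ψ i q ∂(ν i) := by
      intro ψ hψ
      have h := hG _ _ (sub_smooth g L hgL B hB lam ψ hψ)
      rw [hsplit _ _ (linop_good g L hgL B hB lam ψ hψ)] at h
      linarith
    have h1 := key ψ hψ
    have h2 := key (fun i x => -ψ i x) (fun i => ⟨(hψ i).1.neg, fun x w hw => by
      simp only [(hψ i).2 x w hw]⟩)
    have h3 : ∀ i q, linop g B lam (fun i x => -ψ i x) i q = - linop g B lam ψ i q := by
      intro i q
      have : gradient (fun x => -ψ i x) q.1 = - gradient (ψ i) q.1 := by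
        simp only [gradient, fderiv_fun_neg, map_neg]
      simp only [linop, this, inner_neg_right, mul_neg, Finset.sum_neg_distrib]
      ring
    simp only [h3, integral_neg, Finset.sum_neg_distrib] at h2
    exact le_antisymm (by change ∑ i, ∫ q, linop g B lam ψ i q ∂(ν i) ≤ _; linarith) h1
  · intro h
    refine ⟨⟨hfin, hone⟩, fun φ u hF => ?_⟩
    have hφ := hF.1
    rw [hsplit φ _ hφ]
    obtain ⟨T, hT⟩ : ∃ T : ℝ, T = ∑ i, (ν i).real Set.univ := ⟨_, rfl⟩
    have hT0 : 0 ≤ T := by rw [hT]; exact Finset.sum_nonneg fun i _ => measureReal_nonneg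
    refine le_of_forall_pos_le_add fun ε hε => ?_
    obtain ⟨δ, hδ, hδε⟩ : ∃ δ : ℝ, 0 < δ ∧ δ * (T + 1) = ε :=
      ⟨ε / (T + 1), by positivity, by field_simp⟩
    obtain ⟨ψ, hψ, hz, hle⟩ := sub_mol g L hgL hcoer B hB lam φ u hF z k δ hδ
    have h1 : ∑ i, ∫ q, linop g B lam ψ i q ∂(ν i) = ψ k z := h ψ hψ
    have h2 : ∑ i, ∫ q, linop g B lam ψ i q ∂(ν i) ≤ ∑ i, ((∫ q, φ i q ∂(ν i)) + δ * (ν i).real Set.univ) := by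
      refine Finset.sum_le_sum fun i _ => ?_
      haveI := hfin i
      have hl := linop_good g L hgL B hB lam ψ hψ i
      have hφi := torus2_int _ (hφ i).1 (hφ i).2 (ν i)
      refine (integral_mono (torus2_int _ hl.1 hl.2 _) (hφi.add (integrable_const δ)) (hle i)).trans ?_
      simp only [Pi.add_apply]
      rw [integral_add hφi (integrable_const δ), integral_const, smul_eq_mul, mul_comm δ]
    rw [Finset.sum_add_distrib, ← Finset.mul_sum, ← hT] at h2
    linarith
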